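/- The point 4/√17 is an isolated point of the spectrum 𝕃₂, i.e., there exists ε > 0 such that the interval (4/√17 − ε, 4/√17 + ε) contains no element of 𝕃₂ other than 4/√17 itself. -/

import Mathlib

open Filter

/-- The tails `αₙ = [aₙ; aₙ₊₁, …]` of the continued fraction of `α`. -/
noncomputable def cfTail (α : ℝ) : ℕ → ℝ
  | 0 => α
  | n + 1 => (Int.fract (cfTail α n))⁻¹

/-- The partial quotients `aₙ` of the continued fraction of `α`. -/
noncomputable def cfDigit (α : ℝ) (n : ℕ) : ℤ := ⌊cfTail α n⌋

/-- Value `[a; b, c, …]` of a finite continued fraction given by a list. -/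
noncomputable def finCF : List ℤ → ℝ
  | [] => 0
  | a :: l => (a : ℝ) + (finCF l)⁻¹

/-- `α*ₙ = [0; aₙ, aₙ₋₁, …, a₁]`. -/
noncomputable def cfStar (α : ℝ) (n : ℕ) : ℝ :=
  (finCF (((List.range' 1 n).reverse).map (cfDigit α)))⁻¹

/-- Numerators `pₙ` of the convergents of `α`. -/
noncomputable def cfNum (α : ℝ) : ℕ → ℤ
  | 0 => cfDigit α 0
  | 1 => cfDigit α 1 * cfDigit α 0 + 1
  | n + 2 => cfDigit α (n + 2) * cfNum α (n + 1) + cfNum α n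

/-- Denominators `qₙ` of the convergents of `α`. -/
noncomputable def cfDen (α : ℝ) : ℕ → ℤ
  | 0 => 1
  | 1 => cfDigit α 1
  | n + 2 => cfDigit α (n + 2) * cfDen α (n + 1) + cfDen α n

/-- The irrationality measure function `ψ_α^[2]` for "second best" approximations. -/
noncomputable def psi2 (α : ℝ) (t : ℝ) : ℝ :=
  sInf { x : ℝ | ∃ p q : ℤ, 1 ≤ q ∧ (q : ℝ) ≤ t ∧
    (∀ n : ℕ, (p, q) ≠ (cfNum α n, cfDen α n)) ∧ x = |(q : ℝ) * α - (p : ℝ)| }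

/-- The Diophantine constant `𝔨(α) = liminf_{t → ∞} t · ψ_α^[2](t)`. -/
noncomputable def kConst (α : ℝ) : ℝ := liminf (fun t : ℝ => t * psi2 α t) atTop

/-- Two numbers are equivalent if the tails of their continued fraction expansions
coincide: `a_{n+k} = b_{m+k}` for all `k ≥ 1`, for some positive integers `m`, `n`. -/
def CFEquiv (α β : ℝ) : Prop :=
  ∃ n m : ℕ, 0 < n ∧ 0 < m ∧ ∀ k : ℕ, 0 < k → cfDigit α (n + k) = cfDigit β (m + k)

/-- The spectrum `𝕃₂` of values of `𝔨`. -/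
def L2 : Set ℝ := { l : ℝ | ∃ α : ℝ, Irrational α ∧ l = kConst α }

/-- `κ¹ₙ(α) = (1 + α*ₙ₋₁)(αₙ − 1)/(αₙ + α*ₙ₋₁)`. -/
noncomputable def kappa1 (α : ℝ) (n : ℕ) : ℝ :=
  (1 + cfStar α (n - 1)) * (cfTail α n - 1) / (cfTail α n + cfStar α (n - 1))

/-- `κ²ₙ(α) = (1 − α*ₙ)(αₙ₊₁ + 1)/(αₙ₊₁ + α*ₙ)`. -/
noncomputable def kappa2 (α : ℝ) (n : ℕ) : ℝ :=
  (1 - cfStar α n) * (cfTail α (n + 1) + 1) / (cfTail α (n + 1) + cfStar α n)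

/-- `κ⁴ₙ(α) = 4/(αₙ + α*ₙ₋₁)`. -/
noncomputable def kappa4 (α : ℝ) (n : ℕ) : ℝ :=
  4 / (cfTail α n + cfStar α (n - 1))

theorem irrational_cfTail {α : ℝ} (hα : Irrational α) (n : ℕ) : Irrational (cfTail α n) := by
  induction n with
  | zero => exact hα
  | succ n ih =>
    rw [cfTail, ← Int.self_sub_floor]
    exact (ih.sub_intCast _).inv

theorem one_lt_cfTail_succ {α : ℝ} (hα : Irrational α) (n : ℕ) : 1 < cfTail α (n + 1) := by
  rw [cfTail]
  have h0 : 0 < Int.fract (cfTail α n) :=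
    Int.fract_pos.2 ((irrational_cfTail hα n).ne_int _)
  exact (one_lt_inv₀ h0).2 (Int.fract_lt_one _)

theorem cfTail_eq_add_inv (α : ℝ) (n : ℕ) :
    cfTail α n = cfDigit α n + (cfTail α (n + 1))⁻¹ := by
  rw [cfTail, inv_inv, cfDigit, Int.floor_add_fract]

theorem cfTail_mul_succ {α : ℝ} (hα : Irrational α) (n : ℕ) :
    cfTail α n * cfTail α (n + 1) = cfDigit α n * cfTail α (n + 1) + 1 := by
  have h := (irrational_cfTail hα (n + 1)).ne_zero
  rw [cfTail_eq_add_inv α n, add_mul, inv_mul_cancel₀ h]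

theorem one_le_cfDigit_succ {α : ℝ} (hα : Irrational α) (n : ℕ) : 1 ≤ cfDigit α (n + 1) :=
  Int.le_floor.2 (by exact_mod_cast (one_lt_cfTail_succ hα n).le)

theorem cfDen_pos {α : ℝ} (hα : Irrational α) (n : ℕ) : 0 < cfDen α n := by
  induction n using Nat.twoStepInduction with
  | zero => simp [cfDen]
  | one => exact one_le_cfDigit_succ hα 0
  | more n h0 h1 =>
    have := one_le_cfDigit_succ hα (n + 1)
    rw [cfDen]
    positivity

theorem cfDen_mono {α : ℝ} (hα : Irrational α) : Monotone (cfDen α) := by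
  refine monotone_nat_of_le_succ fun n => ?_
  cases n with
  | zero => exact one_le_cfDigit_succ hα 0
  | succ n =>
    have := one_le_cfDigit_succ hα (n + 1)
    have := cfDen_pos hα n
    have := cfDen_pos hα (n + 1)
    rw [cfDen]
    nlinarith

theorem le_cfDen {α : ℝ} (hα : Irrational α) (n : ℕ) : (n : ℤ) ≤ cfDen α n := by
  induction n using Nat.twoStepInduction with
  | zero => simp [cfDen]
  | one => exact_mod_cast one_le_cfDigit_succ hα 0
  | more n h0 h1 =>
    have := one_le_cfDigit_succ hα (n + 1)
    have := cfDen_pos hα n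
    have := cfDen_pos hα (n + 1)
    rw [cfDen]
    push_cast at *
    nlinarith

theorem cfNum_mul_cfDen_sub (α : ℝ) (n : ℕ) :
    cfNum α (n + 1) * cfDen α n - cfNum α n * cfDen α (n + 1) = (-1) ^ n := by
  induction n with
  | zero => simp [cfNum, cfDen]; ring
  | succ n ih =>
    rw [cfNum, cfDen, pow_succ, ← ih]
    ring

theorem isCoprime_cfNum_cfDen (α : ℝ) (n : ℕ) : IsCoprime (cfNum α n) (cfDen α n) := by
  have h := cfNum_mul_cfDen_sub α n
  have h2 : ((-1 : ℤ) ^ n) * (-1) ^ n = 1 := by rw [← mul_pow]; simp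
  refine ⟨-(-1) ^ n * cfDen α (n + 1), (-1) ^ n * cfNum α (n + 1), ?_⟩
  linear_combination (-1) ^ n * h + h2

theorem mul_cfDen_tail {α : ℝ} (hα : Irrational α) (n : ℕ) :
    α * (cfDen α (n + 1) * cfTail α (n + 2) + cfDen α n) =
      cfNum α (n + 1) * cfTail α (n + 2) + cfNum α n := by
  induction n with
  | zero =>
    have h0 : α * cfTail α 1 = _ := cfTail_mul_succ hα 0
    have h1 := cfTail_mul_succ hα 1
    simp only [cfNum, cfDen, zero_add]
    push_cast
    linear_combination cfTail α 2 * h0 - (α - cfDigit α 0) * h1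
  | succ n ih =>
    rw [cfNum, cfDen]
    push_cast
    linear_combination cfTail α (n + 3) * ih -
      (α * cfDen α (n + 1) - cfNum α (n + 1)) * cfTail_mul_succ hα (n + 2)

/-- The distance `|qα - p|` in the coordinates of two consecutive convergents. -/
theorem abs_dist_mul {α : ℝ} (hα : Irrational α) (n : ℕ) (a b : ℝ) :
    |(a * cfDen α (n + 1) + b * cfDen α n) * α - (a * cfNum α (n + 1) + b * cfNum α n)| *
      (cfDen α (n + 1) * cfTail α (n + 2) + cfDen α n) = |a - b * cfTail α (n + 2)| := by
  have hq1 : (0 : ℝ) < cfDen α (n + 1) := by exact_mod_cast cfDen_pos hα (n + 1)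
  have hq0 : (0 : ℝ) < cfDen α n := by exact_mod_cast cfDen_pos hα n
  have hx : 0 < cfTail α (n + 2) := by linarith [one_lt_cfTail_succ hα (n + 1)]
  have hdet : (cfNum α (n + 1) * cfDen α n - cfNum α n * cfDen α (n + 1) : ℝ) = (-1) ^ n := by
    exact_mod_cast cfNum_mul_cfDen_sub α n
  have hL : 0 < cfDen α (n + 1) * cfTail α (n + 2) + cfDen α n := by positivity
  have key : ((a * cfDen α (n + 1) + b * cfDen α n) * α -
      (a * cfNum α (n + 1) + b * cfNum α n)) *
      (cfDen α (n + 1) * cfTail α (n + 2) + cfDen α n) =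
      (-1) ^ (n + 1) * (a - b * cfTail α (n + 2)) := by
    rw [pow_succ, ← hdet]
    linear_combination (a * cfDen α (n + 1) + b * cfDen α n) * mul_cfDen_tail hα n
  have := congrArg abs key
  rwa [abs_mul, abs_of_pos hL, abs_mul, abs_pow, abs_neg, abs_one, one_pow, one_mul] at this

/-- The pair `(p, q)` is not a convergent of `α`. -/
def NotConvergent (α : ℝ) (p q : ℤ) : Prop :=
  ∀ n : ℕ, (p, q) ≠ (cfNum α n, cfDen α n)

theorem notConvergent_two_mul (α : ℝ) (p q : ℤ) : NotConvergent α (2 * p) (2 * q) := by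
  intro n h
  rw [Prod.mk.injEq] at h
  have hc := isCoprime_cfNum_cfDen α n
  rw [← h.1, ← h.2] at hc
  have := hc.isUnit_of_dvd' (Dvd.intro _ rfl) (Dvd.intro _ rfl)
  rw [Int.isUnit_iff] at this
  omega

theorem notConvergent_intermediate {α : ℝ} (hα : Irrational α) (n : ℕ) {j : ℤ} (hj : 1 ≤ j)
    (hj' : j < cfDigit α (n + 2)) :
    NotConvergent α (j * cfNum α (n + 1) + cfNum α n) (j * cfDen α (n + 1) + cfDen α n) := by
  intro m h
  rw [Prod.mk.injEq] at h
  have h0 := cfDen_pos hα n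
  have h1 := cfDen_pos hα (n + 1)
  rcases le_or_gt m (n + 1) with hm | hm
  · have := cfDen_mono hα hm
    nlinarith [h.2]
  · have := cfDen_mono hα (Nat.succ_le_of_lt hm)
    rw [Nat.succ_eq_add_one, cfDen] at this
    nlinarith [h.2]

theorem cfTail_shift (α : ℝ) (n : ℕ) : cfTail α (n + 1) = cfTail (Int.fract α)⁻¹ n := by
  induction n with
  | zero => rfl
  | succ n ih => rw [cfTail, ih, cfTail]

theorem cfDigit_shift (α : ℝ) (n : ℕ) : cfDigit α (n + 1) = cfDigit (Int.fract α)⁻¹ n := by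
  rw [cfDigit, cfTail_shift, cfDigit]

theorem cfDen_shift (α : ℝ) (n : ℕ) : cfDen α (n + 1) = cfNum (Int.fract α)⁻¹ n := by
  induction n using Nat.twoStepInduction with
  | zero => simp [cfDen, cfNum, cfDigit_shift α 0]
  | one => simp [cfDen, cfNum, cfDigit_shift α 0, cfDigit_shift α 1]
  | more n h0 h1 => rw [cfDen, cfNum, h0, h1, cfDigit_shift α (n + 2)]

theorem cfNum_shift (α : ℝ) (n : ℕ) : cfNum α (n + 1) =
    ⌊α⌋ * cfNum (Int.fract α)⁻¹ n + cfDen (Int.fract α)⁻¹ n := by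
  have h : cfDigit α 0 = ⌊α⌋ := rfl
  induction n using Nat.twoStepInduction with
  | zero =>
    simp only [cfDen, cfNum, cfDigit_shift α 0, h]
    ring
  | one =>
    simp only [cfDen, cfNum, cfDigit_shift α 0, cfDigit_shift α 1, h]
    ring
  | more n h0 h1 =>
    rw [cfNum, cfDen.eq_3, h0, h1, cfDigit_shift α (n + 2), cfNum.eq_3 (Int.fract α)⁻¹]
    ring

theorem convergent_eq_cfNum_div_cfDen {α : ℝ} (hα : Irrational α) (n : ℕ) :
    α.convergent n = (cfNum α n : ℚ) / cfDen α n := by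
  induction n generalizing α with
  | zero => simp [cfNum, cfDen, cfDigit, cfTail]
  | succ n ih =>
    have hβ : Irrational (Int.fract α)⁻¹ := irrational_cfTail hα 1
    have hpos := cfDen_pos hα (n + 1)
    rw [cfDen_shift] at hpos
    have hpos' : (0 : ℚ) < cfNum (Int.fract α)⁻¹ n := by exact_mod_cast hpos
    rw [Real.convergent_succ, ih hβ, cfDen_shift, cfNum_shift]
    push_cast
    rw [inv_div, add_div, mul_div_cancel_right₀ _ hpos'.ne']

/-- Legendre's criterion for the pairs `(cfNum α n, cfDen α n)`. -/
theorem not_notConvergent_of_mul_abs_lt {α : ℝ} (hα : Irrational α) {p q : ℤ} (hq : 0 < q)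
    (hpq : IsCoprime p q) (h : q * |q * α - p| < 1 / 2) : ¬ NotConvergent α p q := by
  have hqR : (0 : ℝ) < q := by exact_mod_cast hq
  have hden : (((p : ℚ) / q).den : ℤ) = q :=
    Rat.den_div_eq_of_coprime hq (Int.isCoprime_iff_gcd_eq_one.1 hpq)
  have hden' : ((((p : ℚ) / q).den : ℕ) : ℝ) = q := by exact_mod_cast hden
  obtain ⟨n, hn⟩ := Real.exists_rat_eq_convergent (ξ := α) (q := (p : ℚ) / q) (by
    rw [hden']
    push_cast
    have : |α - p / q| = |q * α - p| / q := by
      rw [← abs_of_pos hqR, ← abs_div, abs_of_pos hqR]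
      congr 1
      field_simp
    rw [this, div_lt_div_iff₀ hqR (by positivity)]
    nlinarith)
  rw [convergent_eq_cfNum_div_cfDen hα] at hn
  obtain ⟨h1, h2⟩ := Rat.div_int_inj hq (cfDen_pos hα n)
    (Int.isCoprime_iff_gcd_eq_one.1 hpq)
    (Int.isCoprime_iff_gcd_eq_one.1 (isCoprime_cfNum_cfDen α n)) hn
  exact fun hc => hc n (by rw [h1, h2])

theorem exists_forall_le_of_eventually_le {α c : ℝ} (h : ∀ᶠ t in atTop, c ≤ t * psi2 α t) :
    ∃ T : ℝ, ∀ p q : ℤ, NotConvergent α p q → T ≤ q → c ≤ q * |q * α - p| := by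
  obtain ⟨T, hT⟩ := eventually_atTop.1 h
  refine ⟨max T 1, fun p q hpq hq => (hT q (le_of_max_le_left hq)).trans ?_⟩
  have hq1 : (1 : ℝ) ≤ q := le_of_max_le_right hq
  refine mul_le_mul_of_nonneg_left (csInf_le ⟨0, ?_⟩ ⟨p, q, ?_, le_rfl, hpq, rfl⟩) (by linarith)
  · rintro _ ⟨p, q, -, -, -, rfl⟩
    exact abs_nonneg _
  · exact_mod_cast hq1

theorem exists_pos_le_abs_mul_sub {α : ℝ} (hα : Irrational α) (Q : ℕ) :
    ∃ m : ℝ, 0 < m ∧ ∀ p q : ℤ, 1 ≤ q → q ≤ Q → m ≤ |q * α - p| := by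
  induction Q with
  | zero => exact ⟨1, one_pos, fun p q h1 h2 => by norm_num at h2; omega⟩
  | succ Q ih =>
    obtain ⟨m, hm, h⟩ := ih
    set r : ℝ := (Q + 1 : ℕ) * α
    have hr : Irrational r := hα.natCast_mul (Nat.succ_ne_zero Q)
    refine ⟨min m |r - round r|, lt_min hm (abs_pos.2 (sub_ne_zero.2 (hr.ne_int _))),
      fun p q h1 h2 => ?_⟩
    rcases h2.lt_or_eq with h2 | h2
    · exact (min_le_left _ _).trans (h p q h1 (by push_cast at h2; omega))
    · refine (min_le_right _ _).trans ?_
      have : (q : ℝ) * α = r := by rw [h2]; simp [r]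
      rw [this]
      exact round_le r p

theorem eventually_le_of_forall_le {α c : ℝ} (hα : Irrational α) {T : ℝ}
    (h : ∀ p q : ℤ, NotConvergent α p q → T ≤ q → c ≤ q * |q * α - p|) :
    ∀ᶠ t in atTop, c ≤ t * psi2 α t := by
  obtain ⟨m, hm, hmin⟩ := exists_pos_le_abs_mul_sub hα ⌈T⌉₊
  filter_upwards [eventually_ge_atTop 2, eventually_ge_atTop (c / m)] with t ht2 htm
  have ht : 0 < t := by linarith
  rw [mul_comm, ← div_le_iff₀ ht]
  refine le_csInf ⟨_, 0, 2, by norm_num, by exact_mod_cast ht2,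
    notConvergent_two_mul α 0 1, rfl⟩ ?_
  rintro _ ⟨p, q, hq1, hqt, hpq, rfl⟩
  rw [div_le_iff₀ ht, mul_comm]
  rcases le_or_gt T q with hTq | hTq
  · exact (h p q hpq hTq).trans (mul_le_mul_of_nonneg_right hqt (abs_nonneg _))
  · have hq : q ≤ ⌈T⌉₊ := by exact_mod_cast hTq.le.trans (Nat.le_ceil T)
    calc c ≤ t * m := (div_le_iff₀ hm).1 htm
      _ ≤ _ := mul_le_mul_of_nonneg_left (hmin p q hq1 hq) ht.le

/-- The necessary conditions on consecutive digits given by the doubled convergents and by the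
intermediate fractions. -/
theorem exists_forall_digit_conditions {α c : ℝ} (hα : Irrational α)
    (h : ∀ᶠ t in atTop, c ≤ t * psi2 α t) :
    ∃ N : ℕ, ∀ n ≥ N,
      c * (cfTail α (n + 2) + cfDen α n / cfDen α (n + 1)) ≤ 4 ∧
      ∀ j : ℤ, 1 ≤ j → j < cfDigit α (n + 2) →
        c * (cfTail α (n + 2) + cfDen α n / cfDen α (n + 1)) ≤
          (j + cfDen α n / cfDen α (n + 1)) * (cfTail α (n + 2) - j) := by
  obtain ⟨T, hT⟩ := exists_forall_le_of_eventually_le h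
  refine ⟨⌈T⌉₊, fun n hn => ?_⟩
  have hTn : T ≤ n := Nat.ceil_le.1 hn
  have hn1 : ((n + 1 : ℕ) : ℝ) ≤ cfDen α (n + 1) := by exact_mod_cast le_cfDen hα (n + 1)
  push_cast at hn1
  have hq1 : (0 : ℝ) < cfDen α (n + 1) := by exact_mod_cast cfDen_pos hα (n + 1)
  have hq0 : (0 : ℝ) < cfDen α n := by exact_mod_cast cfDen_pos hα n
  have hx := one_lt_cfTail_succ hα (n + 1)
  set x := cfTail α (n + 2)
  set Q : ℝ := ((cfDen α (n + 1) : ℤ) : ℝ)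
  set Q' : ℝ := ((cfDen α n : ℤ) : ℝ)
  have hL : 0 < Q * x + Q' := by positivity
  have hxy : x + Q' / Q = (Q * x + Q') / Q := by field_simp
  refine ⟨?_, fun j hj hj' => ?_⟩
  · have h1 := hT _ _ (notConvergent_two_mul α (cfNum α (n + 1)) (cfDen α (n + 1)))
      (by push_cast; linarith)
    have h2 := abs_dist_mul hα n 2 0
    simp only [zero_mul, add_zero, sub_zero, abs_two] at h2
    push_cast at h1
    rw [hxy, ← mul_div_assoc, div_le_iff₀ hq1]
    calc c * (Q * x + Q') ≤ _ := mul_le_mul_of_nonneg_right h1 hL.le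
      _ = 2 * Q * 2 := by rw [mul_assoc, h2]
      _ = 4 * Q := by ring
  · have hj0 : (1 : ℝ) ≤ j := by exact_mod_cast hj
    have h1 := hT _ _ (notConvergent_intermediate hα n hj hj') (by push_cast; nlinarith)
    have h2 := abs_dist_mul hα n j 1
    have hjx : (j : ℝ) < x := by
      refine lt_of_lt_of_le ?_ (Int.floor_le x)
      exact_mod_cast hj'
    simp only [one_mul] at h2
    rw [abs_sub_comm (j : ℝ), abs_of_pos (sub_pos.2 hjx)] at h2
    push_cast at h1
    rw [hxy, ← mul_div_assoc, div_le_iff₀ hq1]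
    calc c * (Q * x + Q') ≤ _ := mul_le_mul_of_nonneg_right h1 hL.le
      _ = (j * Q + Q') * (x - j) := by rw [mul_assoc, h2]
      _ = (j + Q' / Q) * (x - j) * Q := by field_simp

/-- Digit sequences satisfying the conditions with a constant close to `4 / √17` consist of
the digits `1` and `3`, and are periodic with period `3, 1, 1` after any occurrence of `3`. -/
theorem digits_of_conditions {d : ℕ → ℤ} {U Y : ℕ → ℝ}
    (hU : ∀ n, U n * (d (n + 1) + U (n + 1)) = 1) (hY : ∀ n, Y (n + 1) * (d n + Y n) = 1)
    (hU0 : ∀ n, 0 < U n) (hY0 : ∀ n, 0 < Y n)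
    (hd : ∀ n, 1 ≤ d n) (h4 : ∀ n, 0.965 * (d n + U n + Y n) ≤ 4)
    (hj : ∀ n, ∀ j : ℤ, 1 ≤ j → j < d n →
      0.965 * (d n + U n + Y n) ≤ (j + Y n) * (d n + U n - j)) :
    (∀ n, d (n + 2) = 1 ∨ d (n + 2) = 3) ∧
      ∀ n, d (n + 4) = 3 → d (n + 5) = 1 ∧ d (n + 6) = 1 ∧ d (n + 7) = 3 := by
  have hdR : ∀ n, (1 : ℝ) ≤ d n := fun n => by exact_mod_cast hd n
  have hUl : ∀ n, 0.241 ≤ U n := fun n => by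
    nlinarith [hU n, h4 (n + 1), hU0 n, hY0 (n + 1)]
  have hYl : ∀ n, 0.241 ≤ Y (n + 1) := fun n => by
    nlinarith [hY n, h4 n, hU0 n, hY0 (n + 1)]
  have hUu : ∀ n, U n ≤ 0.806 := fun n => by
    nlinarith [hU n, hUl (n + 1), hdR (n + 1), hU0 n]
  have hYu : ∀ n, Y (n + 2) ≤ 0.806 := fun n => by
    nlinarith [hY (n + 1), hYl n, hdR (n + 1), hY0 (n + 2)]
  have hd3 : ∀ n, d n ≤ 3 := fun n => by
    by_contra! hc
    have : (4 : ℝ) ≤ d n := by exact_mod_cast hc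
    linarith [h4 n, hUl n, hY0 n]
  have hdig : ∀ n, d (n + 2) = 1 ∨ d (n + 2) = 3 := fun n => by
    have h1 := hd (n + 2)
    have h3 := hd3 (n + 2)
    by_contra! hc
    have h2 : d (n + 2) = 2 := by omega
    have := hj (n + 2) 1 le_rfl (by omega)
    rw [h2] at this
    push_cast at this
    nlinarith [hUu (n + 2), hYu n, hU0 (n + 2), hY0 (n + 2)]
  have hU3 : ∀ n, d (n + 1) = 3 → U n ≤ 0.334 := fun n h => by
    have := hU n
    rw [h] at this
    push_cast at this
    nlinarith [hU0 n, hU0 (n + 1)]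
  have hY3 : ∀ n, d n = 3 → Y (n + 1) ≤ 0.334 := fun n h => by
    have := hY n
    rw [h] at this
    push_cast at this
    nlinarith [hY0 n, hY0 (n + 1)]
  have hUlow : ∀ n b, d (n + 1) = 1 → U (n + 1) ≤ b → 1 ≤ U n * (1 + b) := fun n b h hb => by
    have := hU n
    rw [h] at this
    push_cast at this
    nlinarith [hU0 n]
  have hYlow : ∀ n b, d n = 1 → Y n ≤ b → 1 ≤ Y (n + 1) * (1 + b) := fun n b h hb => by
    have := hY n
    rw [h] at this
    push_cast at this
    nlinarith [hY0 (n + 1)]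
  refine ⟨hdig, fun n h => ?_⟩
  have e1 := hj (n + 4) 1 le_rfl (by omega)
  have e2 := hj (n + 4) 2 (by norm_num) (by omega)
  have e4 := h4 (n + 4)
  rw [h] at e1 e2 e4
  push_cast at e1 e2 e4
  have hu := hUu (n + 4)
  have hu0 := hU0 (n + 4)
  have hy := hYu (n + 2)
  have hy0 := hY0 (n + 4)
  have d5 : d (n + 5) = 1 := (hdig (n + 3)).resolve_right fun hc => by
    have := hU3 (n + 4) hc
    nlinarith
  have d3 : d (n + 3) = 1 := (hdig (n + 1)).resolve_right fun hc => by
    have := hY3 (n + 3) hc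
    nlinarith
  have ul := hUlow (n + 4) 0.806 d5 (hUu (n + 5))
  have yl := hYlow (n + 3) 0.806 d3 (hYu (n + 1))
  have d6 : d (n + 6) = 1 := (hdig (n + 4)).resolve_right fun hc => by
    have := hUlow (n + 4) _ d5 (hU3 (n + 5) hc)
    linarith
  have d2 : d (n + 2) = 1 := (hdig n).resolve_right fun hc => by
    have := hYlow (n + 3) _ d3 (hY3 (n + 2) hc)
    linarith
  refine ⟨d5, d6, (hdig (n + 5)).resolve_left fun d7 => ?_⟩
  have w := hUlow (n + 6) 0.806 d7 (hUu (n + 7))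
  have u5 : U (n + 5) ≤ 0.644 := by
    have := hU (n + 5)
    rw [d6] at this
    push_cast at this
    nlinarith [hU0 (n + 5)]
  have y3 : Y (n + 3) ≤ 0.806 := hYu (n + 1)
  have u4 := hUlow (n + 4) _ d5 u5
  have y3' : Y (n + 3) * (1 + 0.241) ≤ 1 := by
    have := hY (n + 2)
    rw [d2] at this
    push_cast at this
    nlinarith [hY0 (n + 3), hYl (n + 1)]
  have y4 := hYlow (n + 3) 0.8059 d3 (by linarith)
  linarith

theorem eq_zero_of_abs_le_mul {z : ℕ → ℝ} {B r : ℝ} (hr0 : 0 ≤ r) (hr : r < 1)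
    (hB : ∀ k, |z k| ≤ B) (h : ∀ k, |z k| ≤ r * |z (k + 1)|) : z 0 = 0 := by
  have hk : ∀ k, |z 0| ≤ r ^ k * |z k| := fun k => by
    induction k with
    | zero => simp
    | succ k ih =>
      calc |z 0| ≤ r ^ k * |z k| := ih
        _ ≤ r ^ k * (r * |z (k + 1)|) := mul_le_mul_of_nonneg_left (h k) (pow_nonneg hr0 k)
        _ = _ := by ring
  have hlim : Tendsto (fun k : ℕ => r ^ k * B) atTop (nhds 0) := by
    simpa using (tendsto_pow_atTop_nhds_zero_of_lt_one hr0 hr).mul_const B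
  have := ge_of_tendsto' hlim fun k =>
    (hk k).trans (mul_le_mul_of_nonneg_left (hB k) (pow_nonneg hr0 k))
  exact abs_nonpos_iff.1 this

theorem cfTail_eq_of_digits_one {α : ℝ} (hα : Irrational α) {n : ℕ}
    (h : ∀ k, cfDigit α (n + 1 + k) = 1) : cfTail α (n + 1) = (1 + √5) / 2 := by
  have hs : √5 ^ 2 = 5 := Real.sq_sqrt (by norm_num)
  have hs2 : 2.2 < √5 := Real.lt_sqrt_of_sq_lt (by norm_num)
  have hs3 : √5 < 2.3 := (Real.sqrt_lt' (by norm_num)).2 (by norm_num)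
  have hX : ∀ k, 1 < cfTail α (n + 1 + k) := fun k => by
    rw [add_right_comm]; exact one_lt_cfTail_succ hα _
  have hX2 : ∀ k, cfTail α (n + 1 + k) < 2 := fun k => by
    have := Int.lt_floor_add_one (cfTail α (n + 1 + k))
    rw [← cfDigit, h k] at this
    norm_num at this
    exact this
  refine sub_eq_zero.1 (eq_zero_of_abs_le_mul (z := fun k => cfTail α (n + 1 + k) - (1 + √5) / 2)
    (B := 1) (r := (√5 - 1) / 2) (by linarith) (by linarith) (fun k => ?_) fun k => ?_)
  · rw [abs_le]
    constructor <;> linarith [hX k, hX2 k]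
  · have e := cfTail_mul_succ hα (n + 1 + k)
    rw [h k, add_assoc (n + 1) k 1] at e
    push_cast at e
    have h1 := hX (k + 1)
    have key : (cfTail α (n + 1 + k) - (1 + √5) / 2) * cfTail α (n + 1 + (k + 1)) =
        -((√5 - 1) / 2 * (cfTail α (n + 1 + (k + 1)) - (1 + √5) / 2)) := by
      linear_combination e - hs / 4
    have := congrArg abs key
    rw [abs_mul, abs_neg, abs_mul, abs_of_pos (by linarith : (0 : ℝ) < (√5 - 1) / 2),
      abs_of_pos (by linarith : 0 < cfTail α (n + 1 + (k + 1)))] at this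
    rw [← this]
    exact le_mul_of_one_le_right (abs_nonneg _) h1.le

theorem cfTail_eq_of_digits_three_one_one {α : ℝ} (hα : Irrational α) {n : ℕ}
    (h3 : ∀ k, cfDigit α (n + 1 + 3 * k) = 3) (h1 : ∀ k, cfDigit α (n + 1 + 3 * k + 1) = 1)
    (h1' : ∀ k, cfDigit α (n + 1 + 3 * k + 2) = 1) : cfTail α (n + 1) = (3 + √17) / 2 := by
  have hs : √17 ^ 2 = 17 := Real.sq_sqrt (by norm_num)
  have hs2 : 4 < √17 := Real.lt_sqrt_of_sq_lt (by norm_num)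
  have hs3 : √17 < 4.2 := (Real.sqrt_lt' (by norm_num)).2 (by norm_num)
  have hX : ∀ k, 3 ≤ cfTail α (n + 1 + 3 * k) := fun k => by
    have := Int.floor_le (cfTail α (n + 1 + 3 * k))
    rw [← cfDigit, h3 k] at this
    exact_mod_cast this
  have hX2 : ∀ k, cfTail α (n + 1 + 3 * k) < 4 := fun k => by
    have := Int.lt_floor_add_one (cfTail α (n + 1 + 3 * k))
    rw [← cfDigit, h3 k] at this
    norm_num at this
    exact this
  refine sub_eq_zero.1 (eq_zero_of_abs_le_mul
    (z := fun k => cfTail α (n + 1 + 3 * k) - (3 + √17) / 2)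
    (B := 1) (r := √17 - 4) (by linarith) (by linarith) (fun k => ?_) fun k => ?_)
  · rw [abs_le]
    constructor <;> linarith [hX k, hX2 k]
  · have e0 := cfTail_mul_succ hα (n + 1 + 3 * k)
    have e1 := cfTail_mul_succ hα (n + 1 + 3 * k + 1)
    have e2 := cfTail_mul_succ hα (n + 1 + 3 * k + 2)
    rw [h3 k] at e0
    rw [h1 k] at e1
    rw [h1' k, show n + 1 + 3 * k + 2 + 1 = n + 1 + 3 * (k + 1) by ring] at e2
    push_cast at e0 e1 e2
    have hb := hX (k + 1)
    set X := cfTail α (n + 1 + 3 * k)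
    set X₁ := cfTail α (n + 1 + 3 * k + 1)
    set X₂ := cfTail α (n + 1 + 3 * k + 2)
    set X₃ := cfTail α (n + 1 + 3 * (k + 1))
    have key : (X - (3 + √17) / 2) * (2 * X₃ + 1) = -((√17 - 4) * (X₃ - (3 + √17) / 2)) := by
      linear_combination X₃ * (X₂ * e0 - (X - 3) * e1) - (X - 4) * e2 - hs / 2
    have := congrArg abs key
    rw [abs_mul, abs_neg, abs_mul, abs_of_pos (by linarith : (0 : ℝ) < √17 - 4),
      abs_of_pos (by linarith : 0 < 2 * X₃ + 1)] at this
    rw [← this]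
    exact le_mul_of_one_le_right (abs_nonneg _) (by linarith)

/-- If the continued fraction of `α` has a quadratic tail of discriminant `s ^ 2` whose norm form
only takes values of modulus below `s / 2` or at least `4`, then `t * psi2 α t` is eventually at
least any number below `4 / s`. -/
theorem eventually_le_of_quadratic_tail {α : ℝ} (hα : Irrational α) {n : ℕ} {k l m : ℤ} {s : ℝ}
    (hs : 1 ≤ s) (hk : 2 * cfTail α (n + 2) = k + s)
    (hl : cfTail α (n + 2) ^ 2 = k * cfTail α (n + 2) + l)
    (hf : ∀ a b : ℤ, |a ^ 2 - k * a * b - l * b ^ 2| < 4 → |a ^ 2 - k * a * b - l * b ^ 2| ≤ m)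
    (hm : 2 * m < s) {c : ℝ} (hc : c * s < 4) : ∀ᶠ t in atTop, c ≤ t * psi2 α t := by
  have hθ := irrational_cfTail hα (n + 2)
  have hθ1 := one_lt_cfTail_succ hα (n + 1)
  have hdist := abs_dist_mul hα n
  have hdet := cfNum_mul_cfDen_sub α n
  have hQ : (0 : ℝ) < cfDen α (n + 1) := by exact_mod_cast cfDen_pos hα (n + 1)
  have hQ' : (0 : ℝ) < cfDen α n := by exact_mod_cast cfDen_pos hα n
  have he : ((-1 : ℤ) ^ n) * (-1) ^ n = 1 := by rw [← mul_pow]; simp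
  generalize (-1 : ℤ) ^ n = e at hdet he
  generalize cfTail α (n + 1 + 1) = θ at *
  generalize cfNum α (n + 1) = P at *
  generalize cfNum α n = P' at *
  generalize cfDen α (n + 1) = Q at *
  generalize cfDen α n = Q' at *
  set L : ℝ := Q * θ + Q' with hLdef
  have hL : 0 < L := by positivity
  set C : ℝ := L ^ 2 + s * Q * L with hC
  have hC0 : 0 < C := by positivity
  obtain ⟨η, hη0, hη1, hη2⟩ : ∃ η : ℝ, 0 < η ∧ c * s ≤ 4 - η ∧ m + η ≤ s / 2 :=
    ⟨min (4 - c * s) (s / 2 - m), lt_min (by linarith) (by linarith),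
      by linarith [min_le_left (4 - c * s) (s / 2 - m)],
      by linarith [min_le_right (4 - c * s) (s / 2 - m)]⟩
  refine eventually_le_of_forall_le hα (T := max 1 (16 * C / η + 1)) fun p q hpq hT => ?_
  have hq1 : (1 : ℝ) ≤ q := le_of_max_le_left hT
  have hqη : 16 * C < η * q := by
    rw [← div_lt_iff₀' hη0]
    linarith [le_of_max_le_right hT]
  have hq0 : 0 < q := by exact_mod_cast (by linarith : (0 : ℝ) < q)
  by_contra! hlt
  obtain ⟨a, b, hp, hq⟩ : ∃ a b : ℤ, p = a * P + b * P' ∧ q = a * Q + b * Q' := by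
    refine ⟨e * (p * Q' - q * P'), e * (q * P - p * Q), ?_, ?_⟩
    · linear_combination -e * p * hdet - p * he
    · linear_combination -e * q * hdet - q * he
  have hpR : (p : ℝ) = a * P + b * P' := by exact_mod_cast hp
  have hqR : (q : ℝ) = a * Q + b * Q' := by exact_mod_cast hq
  have hx := hdist a b
  rw [← hpR, ← hqR] at hx
  set x : ℝ := |q * α - p| with hxdef
  have hx0 : 0 < x := abs_pos.2 (sub_ne_zero.2 ((hα.intCast_mul hq0.ne').ne_int p))
  have hqx : q * x * s < 4 - η := (mul_lt_mul_of_pos_right hlt (by linarith)).trans_le hη1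
  have hqx4 : q * x ≤ 4 := by
    have : q * x ≤ q * x * s := le_mul_of_one_le_right (by positivity) hs
    linarith
  set w : ℝ := a - b * θ with hw
  set F : ℤ := a ^ 2 - k * a * b - l * b ^ 2 with hF
  have hFR : (F : ℝ) = w * (w + b * s) := by
    rw [hF, hw]
    push_cast
    linear_combination b * (a - b * θ) * hk + b ^ 2 * hl
  have hFL : (F : ℝ) * L = s * q * w + w ^ 2 * (L - s * Q) := by
    rw [hFR, hqR, hLdef, hw]
    ring
  have hw2 : w ^ 2 = x ^ 2 * L ^ 2 := by rw [← sq_abs w, ← hx]; ring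
  have hsmall : x ^ 2 * C < η := by
    have h2 : q ^ 2 * (x ^ 2 * C) < q ^ 2 * η := by
      calc q ^ 2 * (x ^ 2 * C) = (q * x) ^ 2 * C := by ring
        _ ≤ 4 ^ 2 * C := by gcongr
        _ < η * q := by linarith
        _ ≤ η * q ^ 2 := by gcongr; exact le_self_pow₀ hq1 two_ne_zero
        _ = q ^ 2 * η := mul_comm _ _
    exact lt_of_mul_lt_mul_left h2 (by positivity)
  have hdiff : |(F : ℝ) * L - s * q * w| ≤ x ^ 2 * C * L := by
    rw [hFL, add_sub_cancel_left, abs_mul, abs_of_nonneg (sq_nonneg w), hw2]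
    have : |L - s * Q| ≤ L + s * Q := by
      have : 0 < s * Q := by positivity
      rw [abs_le]
      constructor <;> linarith
    calc x ^ 2 * L ^ 2 * |L - s * Q| ≤ x ^ 2 * L ^ 2 * (L + s * Q) := by gcongr
      _ = _ := by rw [hC]; ring
  have habs : |s * q * w| = s * q * x * L := by
    rw [abs_mul, ← hx, abs_of_pos (by positivity)]
    ring
  have hup : |(F : ℝ)| ≤ s * q * x + x ^ 2 * C := by
    refine le_of_mul_le_mul_right ?_ hL
    have := abs_sub_abs_le_abs_sub ((F : ℝ) * L) (s * q * w)
    rw [abs_mul, abs_of_pos hL, habs] at this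
    linarith
  have hlow : s * q * x ≤ |(F : ℝ)| + x ^ 2 * C := by
    refine le_of_mul_le_mul_right ?_ hL
    have := abs_sub_abs_le_abs_sub (s * q * w) ((F : ℝ) * L)
    rw [abs_mul (F : ℝ), abs_of_pos hL, habs, abs_sub_comm] at this
    linarith
  have hF4 : |F| < 4 := by
    have : |(F : ℝ)| < 4 := by linarith
    exact_mod_cast this
  have hFm : |(F : ℝ)| ≤ m := by exact_mod_cast hf a b hF4
  have hhalf : q * x < 1 / 2 := by
    refine lt_of_mul_lt_mul_left (a := s) ?_ (by linarith)
    linarith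
  have hw0 : w ≠ 0 := fun h => by
    rw [h, abs_zero] at hx
    exact (mul_pos hx0 hL).ne' hx
  have hF0 : F ≠ 0 := fun h => by
    rw [h, Int.cast_zero] at hFR
    have h0 := (mul_eq_zero.1 hFR.symm).resolve_left hw0
    have hb : (b : ℝ) ≠ 0 := fun hb => by
      rw [hb] at h0
      exact hw0 (by linarith)
    refine hθ ⟨k - a / b, ?_⟩
    push_cast
    field_simp
    rw [hw] at h0
    linear_combination -b * hk - h0
  have hcop : IsCoprime p q := by
    rw [Int.isCoprime_iff_gcd_eq_one]
    obtain ⟨u, hu⟩ := Int.gcd_dvd_left p q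
    obtain ⟨v, hv⟩ := Int.gcd_dvd_right p q
    have hg0 : 0 < Int.gcd p q := Int.gcd_pos_of_ne_zero_right p hq0.ne'
    set g : ℤ := (Int.gcd p q : ℤ) with hg
    have ha : a = g * (e * (u * Q' - v * P')) := by
      linear_combination e * Q' * (hu - hp) - e * P' * (hv - hq) - a * e * hdet - a * he
    have hb : b = g * (e * (v * P - u * Q)) := by
      linear_combination e * P * (hv - hq) - e * Q * (hu - hp) - b * e * hdet - b * he
    have hdvd : g ^ 2 ∣ F := by
      rw [hF]
      generalize e * (u * Q' - v * P') = a' at ha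
      generalize e * (v * P - u * Q) = b' at hb
      exact ⟨a' ^ 2 - k * a' * b' - l * b' ^ 2, by rw [ha, hb]; ring⟩
    have hle := Int.le_of_dvd (abs_pos.2 hF0) ((dvd_abs _ _).2 hdvd)
    have : g < 2 := by nlinarith
    omega
  exact not_notConvergent_of_mul_abs_lt hα hq0 hcop hhalf hpq

theorem abs_norm_form_five (a b : ℤ) (h : |a ^ 2 - 1 * a * b - 1 * b ^ 2| < 4) :
    |a ^ 2 - 1 * a * b - 1 * b ^ 2| ≤ 1 := by
  have h4 : ∀ a b : ZMod 4, a ^ 2 - 1 * a * b - 1 * b ^ 2 ≠ 2 := by decide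
  have h9 : ∀ a b : ZMod 9, a ^ 2 - 1 * a * b - 1 * b ^ 2 ≠ 3 ∧
      a ^ 2 - 1 * a * b - 1 * b ^ 2 ≠ -3 := by decide
  generalize hF : a ^ 2 - 1 * a * b - 1 * b ^ 2 = F at h ⊢
  have c4 := h4 a b
  have c9 := h9 a b
  have e4 := congrArg (Int.cast : ℤ → ZMod 4) hF
  have e9 := congrArg (Int.cast : ℤ → ZMod 9) hF
  push_cast at e4 e9
  rw [e4] at c4
  rw [e9] at c9
  rw [abs_lt] at h
  obtain ⟨hl, hu⟩ := h
  interval_cases F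
  · exact absurd (by norm_num) c9.2
  · exact absurd (by decide) c4
  · norm_num
  · norm_num
  · norm_num
  · exact absurd (by norm_num) c4
  · exact absurd (by norm_num) c9.1

theorem abs_norm_form_seventeen (a b : ℤ) (h : |a ^ 2 - 3 * a * b - 2 * b ^ 2| < 4) :
    |a ^ 2 - 3 * a * b - 2 * b ^ 2| ≤ 2 := by
  have h9 : ∀ a b : ZMod 9, a ^ 2 - 3 * a * b - 2 * b ^ 2 ≠ 3 ∧
      a ^ 2 - 3 * a * b - 2 * b ^ 2 ≠ -3 := by decide
  generalize hF : a ^ 2 - 3 * a * b - 2 * b ^ 2 = F at h ⊢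
  have c9 := h9 a b
  have e9 := congrArg (Int.cast : ℤ → ZMod 9) hF
  push_cast at e9
  rw [e9] at c9
  rw [abs_lt] at h
  obtain ⟨hl, hu⟩ := h
  interval_cases F
  · exact absurd (by norm_num) c9.2
  · norm_num
  · norm_num
  · norm_num
  · norm_num
  · norm_num
  · exact absurd (by norm_num) c9.1

theorem le_four_div_sqrt_of_frequently_three {α c : ℝ} (hα : Irrational α)
    (h : ∀ᶠ t in atTop, c ≤ t * psi2 α t) (h3 : ∀ N, ∃ n ≥ N, cfDigit α (n + 2) = 3) :
    c ≤ 4 / √17 := by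
  obtain ⟨N, hN⟩ := exists_forall_digit_conditions hα h
  obtain ⟨n, hn, hd⟩ := h3 N
  obtain ⟨e4, ej⟩ := hN n hn
  have e1 := ej 1 le_rfl (by omega)
  have e2 := ej 2 (by norm_num) (by omega)
  have hX := cfTail_eq_add_inv α (n + 2)
  have hU : 0 < (cfTail α (n + 2 + 1))⁻¹ :=
    inv_pos.2 (by linarith [one_lt_cfTail_succ hα (n + 2)])
  have hQ : (0 : ℝ) < cfDen α (n + 1) := by exact_mod_cast cfDen_pos hα (n + 1)
  have hQ' : (0 : ℝ) < cfDen α n := by exact_mod_cast cfDen_pos hα n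
  have hY := div_pos hQ' hQ
  rw [hX, hd] at e4 e1 e2
  push_cast at e4 e1 e2
  generalize (cfTail α (n + 2 + 1))⁻¹ = U at *
  generalize (cfDen α n / cfDen α (n + 1) : ℝ) = Y at *
  have hs : √17 ^ 2 = 17 := Real.sq_sqrt (by norm_num)
  have hs0 : 0 < √17 := Real.sqrt_pos.2 (by norm_num)
  rw [le_div_iff₀ hs0]
  by_contra! hc
  have hc0 : 0 < c := by nlinarith
  generalize √17 = s at *
  have hv : 3 + U + Y < s := by nlinarith
  have hcontra : (3 + U + Y - s) * (s * (3 + U + Y) + 1) < 0 :=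
    mul_neg_of_neg_of_pos (by linarith) (by positivity)
  have key : ∀ A, c * (3 + U + Y) ≤ A → 4 * A ≤ (2 + (U + Y)) * (4 + (U + Y)) → False := by
    intro A h1 h2
    have : 4 * (3 + U + Y) < s * A := by nlinarith
    nlinarith
  rcases le_total Y U with hYU | hYU
  · exact key _ e1 (by nlinarith)
  · exact key _ e2 (by nlinarith)

theorem le_four_of_eventually_le {α c : ℝ} (hα : Irrational α)
    (h : ∀ᶠ t in atTop, c ≤ t * psi2 α t) : c ≤ 4 := by
  obtain ⟨N, hN⟩ := exists_forall_digit_conditions hα h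
  have h4 := (hN N le_rfl).1
  have hX := one_lt_cfTail_succ hα (N + 1)
  have hY : (0 : ℝ) < cfDen α N / cfDen α (N + 1) :=
    div_pos (by exact_mod_cast cfDen_pos hα N) (by exact_mod_cast cfDen_pos hα (N + 1))
  by_contra! hc
  nlinarith

theorem four_div_le_kConst {α s : ℝ} (hα : Irrational α) (hs : 0 < s)
    (h : ∀ c, c * s < 4 → ∀ᶠ t in atTop, c ≤ t * psi2 α t) : 4 / s ≤ kConst α := by
  rw [kConst, liminf_eq]
  exact le_of_forall_lt fun c hc => by
    obtain ⟨c', hc, hc'⟩ := exists_between hc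
    exact hc.trans_le (le_csSup ⟨4, fun _ => le_four_of_eventually_le hα⟩
      (h c' ((lt_div_iff₀ hs).1 hc')))

/-- If `𝔨(α)` is at least about `4 / √17`, the continued fraction of `α` is eventually `1, 1, …`
or eventually periodic with period `3, 1, 1`. -/
theorem exists_cfTail_eq_or {α : ℝ} (hα : Irrational α)
    (h : ∀ᶠ t in atTop, 0.965 ≤ t * psi2 α t) :
    (∃ n, cfTail α (n + 2) = (1 + √5) / 2) ∨
      (∃ n, cfTail α (n + 2) = (3 + √17) / 2) ∧ ∀ N, ∃ n ≥ N, cfDigit α (n + 2) = 3 := by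
  obtain ⟨N, hN⟩ := exists_forall_digit_conditions hα h
  have hX : ∀ n, 1 < cfTail α (N + n + 3) := fun n => one_lt_cfTail_succ hα _
  have hQ : ∀ n, (0 : ℝ) < cfDen α n := fun n => by exact_mod_cast cfDen_pos hα n
  have hsum : ∀ n, (cfDigit α (N + n + 2) : ℝ) + (cfTail α (N + n + 3))⁻¹ =
    cfTail α (N + n + 2) := fun n => (cfTail_eq_add_inv α (N + n + 2)).symm
  obtain ⟨hdig, hper⟩ := digits_of_conditions (d := fun n => cfDigit α (N + n + 2))
    (U := fun n => (cfTail α (N + n + 3))⁻¹)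
    (Y := fun n => (cfDen α (N + n) / cfDen α (N + n + 1) : ℝ))
    (fun n => by
      rw [hsum]
      exact inv_mul_cancel₀ (by linarith [hX n] : cfTail α (N + n + 3) ≠ 0))
    (fun n => by
      have h1 := hQ (N + n + 1)
      have h2 := hQ (N + n + 2)
      have : (cfDen α (N + n + 2) : ℝ) =
        cfDigit α (N + n + 2) * cfDen α (N + n + 1) + cfDen α (N + n) := by
          rw [cfDen]; push_cast; ring
      change (cfDen α (N + n + 1) / cfDen α (N + n + 2) : ℝ) * _ = 1
      rw [div_mul_eq_mul_div, div_eq_one_iff_eq h2.ne', this]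
      field_simp)
    (fun n => inv_pos.2 (by linarith [hX n])) (fun n => div_pos (hQ _) (hQ _))
    (fun n => one_le_cfDigit_succ hα _)
    (fun n => by rw [hsum]; exact (hN (N + n) (by omega)).1)
    (fun n j h1 h2 => by rw [hsum]; exact (hN (N + n) (by omega)).2 j h1 h2)
  simp only [← add_assoc] at hdig hper
  by_cases hex : ∃ n, cfDigit α (N + n + 4 + 2) = 3
  · obtain ⟨n, hn⟩ := hex
    have h3 : ∀ k, cfDigit α (N + n + 4 + 2 + 3 * k) = 3 := fun k => by
      induction k with
      | zero => exact hn
      | succ k ih =>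
        have := (hper (n + 3 * k) (by rw [← ih]; congr 1; ring)).2.2
        rw [← this]
        congr 1
        ring
    have h1 := fun k => hper (n + 3 * k) (by rw [← h3 k]; congr 1; ring)
    refine Or.inr ⟨⟨N + n + 4, cfTail_eq_of_digits_three_one_one hα (n := N + n + 4 + 1)
      h3 (fun k => ?_) fun k => ?_⟩, fun M => ⟨N + n + 4 + 3 * M, by omega, ?_⟩⟩
    · rw [← (h1 k).1]
      congr 1
      ring
    · rw [← (h1 k).2.1]
      congr 1
      ring
    · rw [← h3 M]
      congr 1
      ring
  · push Not at hex
    refine Or.inl ⟨N + 4, cfTail_eq_of_digits_one hα (n := N + 4 + 1) fun k => ?_⟩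
    have h1 := (hdig (k + 2)).resolve_right (by
      intro hc
      exact hex k (by rw [← hc]; congr 1))
    rw [← h1]
    congr 1
    ring

/-- The point `4/√17` is an isolated point of the spectrum `𝕃₂`. -/
theorem stmt_3 :
    ∃ ε : ℝ, 0 < ε ∧ ∀ x ∈ L2,
      x ∈ Set.Ioo (4 / Real.sqrt 17 - ε) (4 / Real.sqrt 17 + ε) →
      x = 4 / Real.sqrt 17 := by
  refine ⟨0.005, by norm_num, ?_⟩
  rintro _ ⟨α, hα, rfl⟩ ⟨hlow, hup⟩
  have hs : √17 ^ 2 = 17 := Real.sq_sqrt (by norm_num)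
  have hs1 : 4 < √17 := Real.lt_sqrt_of_sq_lt (by norm_num)
  have hs2 : √17 < 4.1234 := (Real.sqrt_lt' (by norm_num)).2 (by norm_num)
  have hr : √5 ^ 2 = 5 := Real.sq_sqrt (by norm_num)
  have hr1 : 2.2 < √5 := Real.lt_sqrt_of_sq_lt (by norm_num)
  have hr2 : √5 < 2.3 := (Real.sqrt_lt' (by norm_num)).2 (by norm_num)
  have hc1 : 0.97 < 4 / √17 := by rw [lt_div_iff₀ (by linarith)]; linarith
  have hc2 : 4 / √17 < 1 := by rw [div_lt_iff₀ (by linarith)]; linarith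
  have hne : {c : ℝ | ∀ᶠ t in atTop, c ≤ t * psi2 α t}.Nonempty := by
    by_contra hne
    rw [Set.not_nonempty_iff_eq_empty] at hne
    rw [kConst, liminf_eq, hne, Real.sSup_empty] at hlow
    linarith
  have hev : ∀ᶠ t in atTop, 0.965 ≤ t * psi2 α t := by
    have : (0.965 : ℝ) < kConst α := by linarith
    rw [kConst, liminf_eq] at this
    obtain ⟨c, hc, hlt⟩ := exists_lt_of_lt_csSup hne this
    exact hc.mono fun t ht => hlt.le.trans ht
  rcases exists_cfTail_eq_or hα hev with ⟨n, hn⟩ | ⟨⟨n, hn⟩, h3⟩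
  · have := four_div_le_kConst hα (by linarith : 0 < √5) fun c hc =>
      eventually_le_of_quadratic_tail hα (n := n) (k := 1) (l := 1) (m := 1) (by linarith)
        (by rw [hn]; push_cast; ring) (by rw [hn]; push_cast; linear_combination hr / 4)
        abs_norm_form_five (by push_cast; linarith) hc
    have h1 : 1.5 < 4 / √5 := by rw [lt_div_iff₀ (by linarith)]; linarith
    linarith
  · refine le_antisymm ?_ (four_div_le_kConst hα (by linarith) fun c hc =>
      eventually_le_of_quadratic_tail hα (n := n) (k := 3) (l := 2) (m := 2) (by linarith)
        (by rw [hn]; push_cast; ring) (by rw [hn]; push_cast; linear_combination hs / 4)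
        abs_norm_form_seventeen (by push_cast; linarith) hc)
    rw [kConst, liminf_eq]
    exact csSup_le hne fun c hc => le_four_div_sqrt_of_frequently_three hα hc h3
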